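/- Let Ω ⊆ ℝ² be open and connected and let f : Ω × ℝ → ℝ be smooth. There is at most one pair (C, η) with C ∈ ℝ and η : Ω → ℝ smooth with ∂η/∂y ≠ 0 everywhere such that for all (x, y) ∈ Ω and all p ∈ ℝ, η_{xx}(x,y) + 2p·η_{xy}(x,y) + p²·η_{yy}(x,y) + η_y(x,y)·f(x,y,p) = 6·η(x,y)² + x + C: if (C₁, η₁) and (C₂, η₂) both satisfy these conditions, then C₁ = C₂ and η₁ = η₂. -/

import Mathlib

/-- Partial derivative in the first variable `x` of a function of `(x, y, p)`. -/
noncomputable def pdx (g : ℝ → ℝ → ℝ → ℝ) : ℝ → ℝ → ℝ → ℝ :=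
  fun x y p => deriv (fun t => g t y p) x

/-- Partial derivative in the second variable `y` of a function of `(x, y, p)`. -/
noncomputable def pdy (g : ℝ → ℝ → ℝ → ℝ) : ℝ → ℝ → ℝ → ℝ :=
  fun x y p => deriv (fun t => g x t p) y

/-- Partial derivative in the third variable `p` of a function of `(x, y, p)`. -/
noncomputable def pdp (g : ℝ → ℝ → ℝ → ℝ) : ℝ → ℝ → ℝ → ℝ :=
  fun x y p => deriv (fun t => g x y t) p

/-- Partial derivative in `x` of a function of `(x, y)`. -/
noncomputable def edx (g : ℝ → ℝ → ℝ) : ℝ → ℝ → ℝ :=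
  fun x y => deriv (fun t => g t y) x

/-- Partial derivative in `y` of a function of `(x, y)`. -/
noncomputable def edy (g : ℝ → ℝ → ℝ) : ℝ → ℝ → ℝ :=
  fun x y => deriv (fun t => g x t) y

section PartialDerivatives

variable {Ω : Set (ℝ × ℝ)} {g h : ℝ → ℝ → ℝ} {w : ℝ × ℝ}

theorem eventually_mem_fst (hΩ : IsOpen Ω) (hw : w ∈ Ω) :
    ∀ᶠ t in nhds w.1, (t, w.2) ∈ Ω :=
  (by fun_prop : Continuous fun t : ℝ => (t, w.2)).continuousAt.eventually_mem
    (hΩ.mem_nhds hw)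

theorem eventually_mem_snd (hΩ : IsOpen Ω) (hw : w ∈ Ω) :
    ∀ᶠ t in nhds w.2, (w.1, t) ∈ Ω :=
  (by fun_prop : Continuous fun t : ℝ => (w.1, t)).continuousAt.eventually_mem
    (hΩ.mem_nhds hw)

theorem edx_congr (hΩ : IsOpen Ω) (hgh : ∀ w ∈ Ω, g w.1 w.2 = h w.1 w.2) (hw : w ∈ Ω) :
    edx g w.1 w.2 = edx h w.1 w.2 :=
  Filter.EventuallyEq.deriv_eq <|
    (eventually_mem_fst hΩ hw).mono fun t ht => hgh (t, w.2) ht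

theorem edy_congr (hΩ : IsOpen Ω) (hgh : ∀ w ∈ Ω, g w.1 w.2 = h w.1 w.2) (hw : w ∈ Ω) :
    edy g w.1 w.2 = edy h w.1 w.2 :=
  Filter.EventuallyEq.deriv_eq <|
    (eventually_mem_snd hΩ hw).mono fun t ht => hgh (w.1, t) ht

theorem hasDerivAt_fst_of_differentiableAt
    (hg : DifferentiableAt ℝ (fun w : ℝ × ℝ => g w.1 w.2) w) :
    HasDerivAt (fun t => g t w.2) (fderiv ℝ (fun w : ℝ × ℝ => g w.1 w.2) w (1, 0)) w.1 :=
  HasFDerivAt.comp_hasDerivAt (f := fun t : ℝ => (t, w.2)) w.1 hg.hasFDerivAt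
    ((hasDerivAt_id w.1).prodMk (hasDerivAt_const w.1 w.2))

theorem hasDerivAt_snd_of_differentiableAt
    (hg : DifferentiableAt ℝ (fun w : ℝ × ℝ => g w.1 w.2) w) :
    HasDerivAt (fun t => g w.1 t) (fderiv ℝ (fun w : ℝ × ℝ => g w.1 w.2) w (0, 1)) w.2 :=
  HasFDerivAt.comp_hasDerivAt (f := fun t : ℝ => (w.1, t)) w.2 hg.hasFDerivAt
    ((hasDerivAt_const w.2 w.1).prodMk (hasDerivAt_id w.2))

theorem edx_eq_fderiv (hg : DifferentiableAt ℝ (fun w : ℝ × ℝ => g w.1 w.2) w) :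
    edx g w.1 w.2 = fderiv ℝ (fun w : ℝ × ℝ => g w.1 w.2) w (1, 0) :=
  (hasDerivAt_fst_of_differentiableAt hg).deriv

theorem edy_eq_fderiv (hg : DifferentiableAt ℝ (fun w : ℝ × ℝ => g w.1 w.2) w) :
    edy g w.1 w.2 = fderiv ℝ (fun w : ℝ × ℝ => g w.1 w.2) w (0, 1) :=
  (hasDerivAt_snd_of_differentiableAt hg).deriv

theorem ContDiffOn.differentiableAt_of_isOpen (hΩ : IsOpen Ω) {F : ℝ × ℝ → ℝ}
    (hF : ContDiffOn ℝ (⊤ : ℕ∞) F Ω) (hw : w ∈ Ω) : DifferentiableAt ℝ F w :=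
  (hF.contDiffAt (hΩ.mem_nhds hw)).differentiableAt (by simp)

theorem ContDiffOn.hasDerivAt_edx (hΩ : IsOpen Ω)
    (hg : ContDiffOn ℝ (⊤ : ℕ∞) (fun w : ℝ × ℝ => g w.1 w.2) Ω) (hw : w ∈ Ω) :
    HasDerivAt (fun t => g t w.2) (edx g w.1 w.2) w.1 :=
  (hasDerivAt_fst_of_differentiableAt
    (hg.differentiableAt_of_isOpen hΩ hw)).differentiableAt.hasDerivAt

theorem ContDiffOn.hasDerivAt_edy (hΩ : IsOpen Ω)
    (hg : ContDiffOn ℝ (⊤ : ℕ∞) (fun w : ℝ × ℝ => g w.1 w.2) Ω) (hw : w ∈ Ω) :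
    HasDerivAt (fun t => g w.1 t) (edy g w.1 w.2) w.2 :=
  (hasDerivAt_snd_of_differentiableAt
    (hg.differentiableAt_of_isOpen hΩ hw)).differentiableAt.hasDerivAt

theorem ContDiffOn.contDiffOn_edx (hΩ : IsOpen Ω)
    (hg : ContDiffOn ℝ (⊤ : ℕ∞) (fun w : ℝ × ℝ => g w.1 w.2) Ω) :
    ContDiffOn ℝ (⊤ : ℕ∞) (fun w : ℝ × ℝ => edx g w.1 w.2) Ω :=
  ((hg.fderiv_of_isOpen hΩ (m := (⊤ : ℕ∞)) (by norm_cast)).clm_apply contDiffOn_const).congr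
    fun _ hw => edx_eq_fderiv (hg.differentiableAt_of_isOpen hΩ hw)

theorem ContDiffOn.contDiffOn_edy (hΩ : IsOpen Ω)
    (hg : ContDiffOn ℝ (⊤ : ℕ∞) (fun w : ℝ × ℝ => g w.1 w.2) Ω) :
    ContDiffOn ℝ (⊤ : ℕ∞) (fun w : ℝ × ℝ => edy g w.1 w.2) Ω :=
  ((hg.fderiv_of_isOpen hΩ (m := (⊤ : ℕ∞)) (by norm_cast)).clm_apply contDiffOn_const).congr
    fun _ hw => edy_eq_fderiv (hg.differentiableAt_of_isOpen hΩ hw)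

/-- Mixed second partial derivatives of a smooth function agree. -/
theorem edx_edy_comm (hΩ : IsOpen Ω)
    (hg : ContDiffOn ℝ (⊤ : ℕ∞) (fun w : ℝ × ℝ => g w.1 w.2) Ω) (hw : w ∈ Ω) :
    edx (edy g) w.1 w.2 = edy (edx g) w.1 w.2 := by
  have hsymm : IsSymmSndFDerivAt ℝ (fun w : ℝ × ℝ => g w.1 w.2) w :=
    (hg.contDiffAt (hΩ.mem_nhds hw)).isSymmSndFDerivAt (by simpa using WithTop.coe_le_coe.2 (le_top (a := (2 : ℕ∞))))
  have hd : DifferentiableAt ℝ (fderiv ℝ fun w : ℝ × ℝ => g w.1 w.2) w :=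
    ((hg.fderiv_of_isOpen hΩ (m := (⊤ : ℕ∞)) (by norm_cast)).contDiffAt
      (hΩ.mem_nhds hw)).differentiableAt (by simp)
  have hx : (fun w : ℝ × ℝ => edx g w.1 w.2) =ᶠ[nhds w]
      fun z => fderiv ℝ (fun w : ℝ × ℝ => g w.1 w.2) z (1, 0) :=
    (hΩ.eventually_mem hw).mono fun _ hz =>
      edx_eq_fderiv (hg.differentiableAt_of_isOpen hΩ hz)
  have hy : (fun w : ℝ × ℝ => edy g w.1 w.2) =ᶠ[nhds w]
      fun z => fderiv ℝ (fun w : ℝ × ℝ => g w.1 w.2) z (0, 1) :=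
    (hΩ.eventually_mem hw).mono fun _ hz =>
      edy_eq_fderiv (hg.differentiableAt_of_isOpen hΩ hz)
  rw [edx_eq_fderiv ((hg.contDiffOn_edy hΩ).differentiableAt_of_isOpen hΩ hw),
    edy_eq_fderiv ((hg.contDiffOn_edx hΩ).differentiableAt_of_isOpen hΩ hw), hx.fderiv_eq, hy.fderiv_eq,
    fderiv_clm_apply hd (differentiableAt_const _), fderiv_clm_apply hd (differentiableAt_const _)]
  simpa using hsymm (1, 0) (0, 1)

theorem edy_edx_edx (hΩ : IsOpen Ω)
    (hg : ContDiffOn ℝ (⊤ : ℕ∞) (fun w : ℝ × ℝ => g w.1 w.2) Ω) (hw : w ∈ Ω) :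
    edy (edx (edx g)) w.1 w.2 = edx (edx (edy g)) w.1 w.2 :=
  (edx_edy_comm hΩ (hg.contDiffOn_edx hΩ) hw).symm.trans
    (edx_congr hΩ (fun _ hz => (edx_edy_comm hΩ hg hz).symm) hw)

end PartialDerivatives

/-- There is at most one transformation `(x, y) ↦ (x + C, η(x, y))`
mapping `y'' = f(x, y, y')` to the first Painlevé equation `ȳ'' = 6ȳ² + x̄`: if two pairs
`(C₁, η₁)` and `(C₂, η₂)` both satisfy the prolongation identity
`η_xx + 2p·η_xy + p²·η_yy + η_y·f = 6η² + x + C` on `Ω × ℝ` (with `η_y ≠ 0`), then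
`C₁ = C₂` and `η₁ = η₂` on `Ω`. -/
theorem statement11
    (Ω : Set (ℝ × ℝ)) (hΩo : IsOpen Ω) (hΩc : IsConnected Ω)
    (f : ℝ → ℝ → ℝ → ℝ)
    (hf : ContDiffOn ℝ (⊤ : ℕ∞) (fun z : ℝ × ℝ × ℝ => f z.1 z.2.1 z.2.2)
      {z : ℝ × ℝ × ℝ | (z.1, z.2.1) ∈ Ω})
    (C₁ C₂ : ℝ) (η₁ η₂ : ℝ → ℝ → ℝ)
    (hη₁ : ContDiffOn ℝ (⊤ : ℕ∞) (fun w : ℝ × ℝ => η₁ w.1 w.2) Ω)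
    (hη₂ : ContDiffOn ℝ (⊤ : ℕ∞) (fun w : ℝ × ℝ => η₂ w.1 w.2) Ω)
    (hηy₁ : ∀ w ∈ Ω, edy η₁ w.1 w.2 ≠ 0)
    (hηy₂ : ∀ w ∈ Ω, edy η₂ w.1 w.2 ≠ 0)
    (hpde₁ : ∀ w ∈ Ω, ∀ p : ℝ,
      edx (edx η₁) w.1 w.2 + 2 * p * edx (edy η₁) w.1 w.2
        + p ^ 2 * edy (edy η₁) w.1 w.2 + edy η₁ w.1 w.2 * f w.1 w.2 p
      = 6 * (η₁ w.1 w.2) ^ 2 + w.1 + C₁)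
    (hpde₂ : ∀ w ∈ Ω, ∀ p : ℝ,
      edx (edx η₂) w.1 w.2 + 2 * p * edx (edy η₂) w.1 w.2
        + p ^ 2 * edy (edy η₂) w.1 w.2 + edy η₂ w.1 w.2 * f w.1 w.2 p
      = 6 * (η₂ w.1 w.2) ^ 2 + w.1 + C₂) :
    C₁ = C₂ ∧ ∀ w ∈ Ω, η₁ w.1 w.2 = η₂ w.1 w.2 := by
  have heq : ∀ w ∈ Ω, η₁ w.1 w.2 = η₂ w.1 w.2 := by
    have hcoeff : ∀ w ∈ Ω, ∀ p : ℝ,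
        edy η₂ w.1 w.2 * (6 * η₁ w.1 w.2 ^ 2 + w.1 + C₁ - edx (edx η₁) w.1 w.2
          - 2 * p * edx (edy η₁) w.1 w.2 - p ^ 2 * edy (edy η₁) w.1 w.2)
        = edy η₁ w.1 w.2 * (6 * η₂ w.1 w.2 ^ 2 + w.1 + C₂ - edx (edx η₂) w.1 w.2
          - 2 * p * edx (edy η₂) w.1 w.2 - p ^ 2 * edy (edy η₂) w.1 w.2) :=
      fun w hw p => by
        linear_combination edy η₁ w.1 w.2 * hpde₂ w hw p - edy η₂ w.1 w.2 * hpde₁ w hw p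
    have hyy : ∀ w ∈ Ω, edy η₂ w.1 w.2 * edy (edy η₁) w.1 w.2
        = edy η₁ w.1 w.2 * edy (edy η₂) w.1 w.2 := fun w hw => by
      linear_combination hcoeff w hw 0 - hcoeff w hw 1 / 2 - hcoeff w hw (-1) / 2
    have hxy : ∀ w ∈ Ω, edy η₂ w.1 w.2 * edx (edy η₁) w.1 w.2
        = edy η₁ w.1 w.2 * edx (edy η₂) w.1 w.2 := fun w hw => by
      linear_combination hcoeff w hw (-1) / 4 - hcoeff w hw 1 / 4
    have hxx : ∀ w ∈ Ω,
        edy η₂ w.1 w.2 * (6 * η₁ w.1 w.2 ^ 2 + w.1 + C₁ - edx (edx η₁) w.1 w.2)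
        = edy η₁ w.1 w.2 * (6 * η₂ w.1 w.2 ^ 2 + w.1 + C₂ - edx (edx η₂) w.1 w.2) :=
      fun w hw => by linear_combination hcoeff w hw 0
    intro w hw
    have hxxy : edy η₂ w.1 w.2 * edx (edx (edy η₁)) w.1 w.2
        = edy η₁ w.1 w.2 * edx (edx (edy η₂)) w.1 w.2 := by
      have h := ((((hη₂.contDiffOn_edy hΩo).hasDerivAt_edx hΩo hw).mul
        (((hη₁.contDiffOn_edy hΩo).contDiffOn_edx hΩo).hasDerivAt_edx hΩo hw)).congr_of_eventuallyEq
          ((eventually_mem_fst hΩo hw).mono fun t ht => (hxy (t, w.2) ht).symm)).unique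
        (((hη₁.contDiffOn_edy hΩo).hasDerivAt_edx hΩo hw).mul
          (((hη₂.contDiffOn_edy hΩo).contDiffOn_edx hΩo).hasDerivAt_edx hΩo hw))
      linear_combination h
    have hA : ∀ (η : ℝ → ℝ → ℝ) (C : ℝ),
        ContDiffOn ℝ (⊤ : ℕ∞) (fun w : ℝ × ℝ => η w.1 w.2) Ω →
        HasDerivAt (fun t => 6 * η w.1 t ^ 2 + w.1 + C - edx (edx η) w.1 t)
          (12 * η w.1 w.2 * edy η w.1 w.2 - edx (edx (edy η)) w.1 w.2) w.2 := by
      intro η C hη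
      refine ((((((hη.hasDerivAt_edy hΩo hw).pow 2).const_mul 6).add_const w.1).add_const C).sub
        (((hη.contDiffOn_edx hΩo).contDiffOn_edx hΩo).hasDerivAt_edy hΩo hw)).congr_deriv ?_
      rw [edy_edx_edx hΩo hη hw]
      push_cast
      ring
    have h := ((((hη₂.contDiffOn_edy hΩo).hasDerivAt_edy hΩo hw).mul
      (hA η₁ C₁ hη₁)).congr_of_eventuallyEq
        ((eventually_mem_snd hΩo hw).mono fun t ht => (hxx (w.1, t) ht).symm)).unique
      (((hη₁.contDiffOn_edy hΩo).hasDerivAt_edy hΩo hw).mul (hA η₂ C₂ hη₂))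
    have h₁ := hηy₁ w hw
    have h₂ := hηy₂ w hw
    have hcancel : edy (edy η₂) w.1 w.2
          * (6 * η₁ w.1 w.2 ^ 2 + w.1 + C₁ - edx (edx η₁) w.1 w.2)
        = edy (edy η₁) w.1 w.2
          * (6 * η₂ w.1 w.2 ^ 2 + w.1 + C₂ - edx (edx η₂) w.1 w.2) := by
      refine mul_left_cancel₀ h₁ ?_
      linear_combination edy (edy η₁) w.1 w.2 * hxx w hw
        - (6 * η₁ w.1 w.2 ^ 2 + w.1 + C₁ - edx (edx η₁) w.1 w.2) * hyy w hw
    refine mul_left_cancel₀ (mul_ne_zero h₁ h₂) ?_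
    linear_combination (h - hcancel + hxxy) / 12
  refine ⟨?_, heq⟩
  obtain ⟨w, hw⟩ := hΩc.nonempty
  have hx : ∀ z ∈ Ω, edx η₁ z.1 z.2 = edx η₂ z.1 z.2 := fun z hz => edx_congr hΩo heq hz
  have hy : edy η₁ w.1 w.2 = edy η₂ w.1 w.2 := edy_congr hΩo heq hw
  have h₁ := hpde₁ w hw 0
  rw [edx_congr hΩo hx hw, hy, heq w hw] at h₁
  linear_combination hpde₂ w hw 0 - h₁
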